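/- arXiv:2603.05376 — 2 statements merged into one kernel-verified Lean document; each statement's English description precedes it below -/
import Mathlib

section
/- Let H be a real Hilbert space, let ρ ∈ (0,∞], and let S ⊆ H be a nonempty closed ρ-uniformly prox-regular set. Let a ∈ H and let r be a real number with 0 < r < ρ such that S ∩ B_r(a) ≠ ∅, where B_r(a) is the open ball of radius r centered at a. Then the closure of S ∩ B_r(a) equals S ∩ B̄_r[a] (the intersection of S with the closed ball of radius r centered at a), and moreover the set S ∩ B̄_r[a] is ρ-uniformly prox-regular. -/
open MeasureTheory Set Metric Filter Topology
open scoped RealInnerProductSpace ENNReal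

/-- The proximal normal cone of `S` at `x`: `ζ ∈ N^P(S;x)` iff there are `σ ≥ 0`, `η > 0`
with `⟪ζ, y - x⟫ ≤ σ‖y - x‖²` for all `y ∈ S` with `‖y - x‖ < η`. -/
def ProxNormalCone {H : Type*} [NormedAddCommGroup H] [InnerProductSpace ℝ H]
    (S : Set H) (x : H) : Set H :=
  {ζ : H | ∃ σ : ℝ, 0 ≤ σ ∧ ∃ η : ℝ, 0 < η ∧
    ∀ y ∈ S, ‖y - x‖ < η → ⟪ζ, y - x⟫ ≤ σ * ‖y - x‖ ^ 2}

/-- `ρ`-uniform prox-regularity, with `ρ ∈ (0,∞]` encoded in `ℝ≥0∞`.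
For `ρ = ∞` one has `‖ζ‖ / (2 * ρ.toReal) = ‖ζ‖ / 0 = 0`, recovering the convex inequality. -/
def UniformlyProxRegular {H : Type*} [NormedAddCommGroup H] [InnerProductSpace ℝ H]
    (ρ : ℝ≥0∞) (S : Set H) : Prop :=
  ∀ x ∈ S, ∀ ζ ∈ ProxNormalCone S x, ∀ x' ∈ S,
    ⟪ζ, x' - x⟫ ≤ ‖ζ‖ / (2 * ρ.toReal) * ‖x' - x‖ ^ 2

/-- Lower semicontinuity of a set-valued map on a set `A`: for every `a ∈ A` and open `U`
meeting `C a`, the set of points of `A` where `C` meets `U` is a neighborhood of `a` in `A`. -/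
def LscOn {α β : Type*} [TopologicalSpace α] [TopologicalSpace β]
    (C : α → Set β) (A : Set α) : Prop :=
  ∀ a ∈ A, ∀ U : Set β, IsOpen U → (C a ∩ U).Nonempty →
    {a' | a' ∈ A ∧ (C a' ∩ U).Nonempty} ∈ nhdsWithin a A

/-- Admissible trajectory for a moving set `C` on `[0,T]`: right-continuous, of bounded
variation, with `x 0 ∈ C 0` and `x t ∈ C t` for all `t ∈ [0,T]`. -/
def AdmissibleTrajectory {E : Type*} [NormedAddCommGroup E]
    (C : ℝ → Set E) (T : ℝ) (x : ℝ → E) : Prop :=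
  (∀ t ∈ Icc (0:ℝ) T, ContinuousWithinAt x (Ici t) t) ∧
    BoundedVariationOn x (Icc (0:ℝ) T) ∧ x 0 ∈ C 0 ∧ ∀ t ∈ Icc (0:ℝ) T, x t ∈ C t

/-- The differential measure `dx` is absolutely continuous w.r.t. `ν` with density
`v ∈ L¹_ν`: `x t = x 0 + ∫_{(0,t]} v dν` for all `t ∈ [0,T]`. -/
def HasDensity {E : Type*} [NormedAddCommGroup E] [NormedSpace ℝ E]
    (T : ℝ) (ν : Measure ℝ) (x v : ℝ → E) : Prop :=
  Integrable v ν ∧ ∀ t ∈ Icc (0:ℝ) T, x t = x 0 + ∫ s in Ioc (0:ℝ) t, v s ∂ν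

/-- A (complete) positive Radon measure on `[0,T]`: a finite inner regular Borel measure
carried by `[0,T]`. -/
def IsRadonOn (ν : Measure ℝ) (T : ℝ) : Prop :=
  IsFiniteMeasure ν ∧ ν.InnerRegular ∧ ν ((Icc (0:ℝ) T)ᶜ) = 0

/-- The bounded selection-extension property (H₃). -/
def SelectionExtension {E : Type*} [NormedAddCommGroup E] (C : ℝ → Set E) (T : ℝ) : Prop :=
  ∀ x : ℝ → E, (∃ M : ℝ, ∀ t ∈ Icc (0:ℝ) T, ‖x t‖ ≤ M) →
    (∀ t ∈ Icc (0:ℝ) T, x t ∈ C t) → ∀ η : ℝ, 0 < η →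
    ∃ R : ℝ, 0 < R ∧
      ∀ K : Set ℝ, IsCompact K → K ⊆ Icc (0:ℝ) T →
        ∀ y : ℝ → E, ContinuousOn y K → (∀ t ∈ K, y t ∈ C t) →
          (∀ t ∈ K, ‖y t - x t‖ ≤ η) →
          ∃ ybar : ℝ → E, ContinuousOn ybar (Icc (0:ℝ) T) ∧
            (∀ t ∈ Icc (0:ℝ) T, ybar t ∈ C t) ∧ (∀ t ∈ K, ybar t = y t) ∧
            ∀ t ∈ Icc (0:ℝ) T, ‖ybar t‖ ≤ R

/-- Hypothesis (H₁): each `C t` is nonempty, closed, connected and `ρ`-uniformly prox-regular. -/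
def HypH1 {H : Type*} [NormedAddCommGroup H] [InnerProductSpace ℝ H]
    (ρ : ℝ≥0∞) (C : ℝ → Set H) (T : ℝ) : Prop :=
  ∀ t ∈ Icc (0:ℝ) T, (C t).Nonempty ∧ IsClosed (C t) ∧ IsConnected (C t) ∧
    UniformlyProxRegular ρ (C t)

section AlmostProximal

variable {E : Type*} [NormedAddCommGroup E]

/-- Points whose almost nearest points in `S` all lie in some ball of radius `η`. -/
def almostProximal (S : Set E) (η : ℝ) : Set E :=
  {z | ∃ δ > 0, ∃ c, ∀ y ∈ S, ‖y - z‖ ≤ infDist z S + δ → ‖y - c‖ < η}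

theorem isOpen_almostProximal (S : Set E) (η : ℝ) : IsOpen (almostProximal S η) := by
  rw [Metric.isOpen_iff]
  rintro z ⟨δ, hδ, c, hc⟩
  refine ⟨δ / 3, by positivity, fun z' hz' => ⟨δ / 3, by positivity, c, fun y hy hyz => ?_⟩⟩
  rw [mem_ball] at hz'
  refine hc y hy ?_
  have h1 : infDist z' S ≤ infDist z S + dist z' z := infDist_le_infDist_add_dist
  have h2 : dist y z ≤ dist y z' + dist z' z := dist_triangle _ _ _
  rw [← dist_eq_norm] at hyz ⊢
  linarith

theorem exists_dist_eq_infDist_of_forall_almostProximal [CompleteSpace E] {S : Set E}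
    (hS : S.Nonempty) (hScl : IsClosed S) {z : E}
    (hz : ∀ n : ℕ, z ∈ almostProximal S (1 / (n + 1))) :
    ∃ p ∈ S, dist z p = infDist z S := by
  have hex : ∀ n : ℕ, ∃ y ∈ S, dist z y < infDist z S + 1 / ((n : ℝ) + 1) := fun n =>
    (infDist_lt_iff hS).1 (lt_add_of_pos_right _ (by positivity))
  choose u huS hu using hex
  have hcau : CauchySeq u := by
    rw [Metric.cauchySeq_iff']
    intro ε hε
    obtain ⟨n, hn⟩ := exists_nat_one_div_lt (half_pos hε)
    obtain ⟨δ, hδ, c, hc⟩ := hz n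
    obtain ⟨N, hN⟩ := exists_nat_one_div_lt hδ
    have key : ∀ m ≥ N, dist (u m) c < ε / 2 := fun m hm => by
      rw [dist_eq_norm]
      refine (hc (u m) (huS m) ?_).trans hn
      rw [← dist_eq_norm, dist_comm]
      have := Nat.one_div_le_one_div (α := ℝ) hm
      linarith [hu m]
    refine ⟨N, fun m hm => ?_⟩
    linarith [dist_triangle_right (u m) (u N) c, key m hm, key N le_rfl]
  obtain ⟨p, hp⟩ := cauchySeq_tendsto_of_complete hcau
  have hpS : p ∈ S := hScl.mem_of_tendsto hp (Eventually.of_forall huS)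
  refine ⟨p, hpS, le_antisymm ?_ (infDist_le_dist_of_mem hpS)⟩
  have h1 : Tendsto (fun n => dist z (u n)) atTop (𝓝 (dist z p)) := tendsto_const_nhds.dist hp
  have h2 : Tendsto (fun n : ℕ => infDist z S + 1 / ((n : ℝ) + 1)) atTop (𝓝 (infDist z S + 0)) :=
    tendsto_const_nhds.add tendsto_one_div_add_atTop_nhds_zero_nat
  rw [add_zero] at h2
  exact le_of_tendsto_of_tendsto' h1 h2 fun n => (hu n).le

end AlmostProximal

section NearestPoints

variable {H : Type*} [NormedAddCommGroup H] [InnerProductSpace ℝ H]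

theorem norm_sub_convexComb_sq (x x' p : H) (t : ℝ) :
    ‖x + t • (x' - x) - p‖ ^ 2 =
      (1 - t) * ‖x - p‖ ^ 2 + t * ‖x' - p‖ ^ 2 - t * (1 - t) * ‖x' - x‖ ^ 2 := by
  have h1 : x + t • (x' - x) - p = (x - p) + t • (x' - x) := by abel
  have h2 : x' - p = (x - p) + (x' - x) := by abel
  rw [h1, h2, norm_add_sq_real, norm_add_sq_real, norm_smul, mul_pow, Real.norm_eq_abs, sq_abs,
    real_inner_smul_right]
  ring

theorem dense_almostProximal {S : Set H} (hS : S.Nonempty) {η : ℝ} (hη : 0 < η) :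
    Dense (almostProximal S η) := by
  rw [Metric.dense_iff]
  intro z ε hε
  set D := infDist z S with hD
  have hD0 : 0 ≤ D := infDist_nonneg
  obtain ⟨l, hl0, hl1, hlε⟩ : ∃ l : ℝ, 0 < l ∧ l < 1 ∧ l * (D + 1) < ε := by
    refine ⟨min (1 / 2) (ε / (2 * (D + 1))), by positivity,
      (min_le_left _ _).trans_lt (by norm_num), ?_⟩
    calc _ ≤ ε / (2 * (D + 1)) * (D + 1) := by gcongr; exact min_le_right _ _
      _ = ε / 2 := by field_simp
      _ < ε := by linarith
  obtain ⟨τ, hτ0, hτ1, hτη⟩ : ∃ τ : ℝ, 0 < τ ∧ τ ≤ 1 ∧ τ * (4 * D + 4) < l * η ^ 2 := by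
    refine ⟨min 1 (l * η ^ 2 / (8 * (D + 1))), by positivity, min_le_left _ _, ?_⟩
    calc _ ≤ l * η ^ 2 / (8 * (D + 1)) * (4 * D + 4) := by gcongr; exact min_le_right _ _
      _ = l * η ^ 2 / 2 := by field_simp; ring
      _ < l * η ^ 2 := by have : 0 < l * η ^ 2 := by positivity
                          linarith
  obtain ⟨c, hcS, hc⟩ := (infDist_lt_iff hS).1 (show infDist z S < D + τ by linarith)
  rw [dist_comm, dist_eq_norm] at hc
  have hN0 := norm_nonneg (c - z)
  refine ⟨z + l • (c - z), ?_, τ, hτ0, c, fun y hy hyz => ?_⟩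
  · rw [mem_ball, dist_eq_norm, add_sub_cancel_left, norm_smul, Real.norm_eq_abs, abs_of_pos hl0]
    have : l * ‖c - z‖ ≤ l * (D + 1) := by gcongr; linarith
    linarith
  · have h1 : infDist (z + l • (c - z)) S ≤ (1 - l) * ‖c - z‖ := by
      refine (infDist_le_dist_of_mem hcS).trans_eq ?_
      have : z + l • (c - z) - c = (l - 1) • (c - z) := by module
      rw [dist_eq_norm, this, norm_smul, Real.norm_eq_abs, abs_of_neg (by linarith)]
      ring
    have h2 : D ≤ ‖y - z‖ := by
      rw [← dist_eq_norm, dist_comm]; exact infDist_le_dist_of_mem hy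
    have h3 := norm_sub_convexComb_sq z c y l
    rw [norm_sub_rev, norm_sub_rev z y, norm_sub_rev c y] at h3
    have h4 : ‖y - (z + l • (c - z))‖ ^ 2 ≤ ((1 - l) * ‖c - z‖ + τ) ^ 2 := by
      gcongr; linarith
    have h5 : D ^ 2 ≤ ‖y - z‖ ^ 2 := by gcongr
    have h6 : (1 - l) * D ^ 2 ≤ (1 - l) * ‖y - z‖ ^ 2 := by
      have : 0 ≤ 1 - l := by linarith
      gcongr
    have h7 : ‖c - z‖ ^ 2 ≤ (D + τ) ^ 2 := by gcongr
    have h8 : (1 - l) * ‖c - z‖ ^ 2 ≤ (1 - l) * (D + τ) ^ 2 := by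
      have : 0 ≤ 1 - l := by linarith
      gcongr
    have h9 : (1 - l) * ‖c - z‖ * τ ≤ (D + 1) * τ := by
      gcongr
      nlinarith
    have h10 : l * ‖y - c‖ ^ 2 ≤ τ * (4 * D + 4) := by
      have : (1 - l) * (τ * (2 * D + τ)) ≤ 1 * (τ * (2 * D + 1)) := by gcongr; linarith
      have : τ ^ 2 ≤ τ := by nlinarith
      nlinarith
    have h11 : ‖y - c‖ ^ 2 < η ^ 2 := by
      have := h10.trans_lt hτη
      exact lt_of_mul_lt_mul_left this hl0.le
    exact lt_of_pow_lt_pow_left₀ 2 hη.le h11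

theorem norm_sub_le_norm_sub_add_smul (x v y : H) {t : ℝ} (ht : 0 ≤ t) :
    ‖y - x‖ ≤ ‖y - (x + t • v)‖ + t * ‖v‖ := by
  have h := norm_add_le (y - (x + t • v)) (t • v)
  rwa [norm_smul, Real.norm_eq_abs, abs_of_nonneg ht, sub_add_eq_add_sub, add_sub_add_right_eq_sub]
    at h

/-- In a Hilbert space, the points having a nearest point in a given nonempty closed set are
dense. -/
theorem dense_setOf_exists_dist_eq_infDist [CompleteSpace H] {S : Set H}
    (hS : S.Nonempty) (hScl : IsClosed S) :
    Dense {z : H | ∃ p ∈ S, dist z p = infDist z S} := by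
  refine (dense_iInter_of_isOpen (fun n : ℕ => isOpen_almostProximal S (1 / ((n : ℝ) + 1)))
    (fun n => dense_almostProximal hS (by positivity))).mono fun z hz => ?_
  exact exists_dist_eq_infDist_of_forall_almostProximal hS hScl (mem_iInter.1 hz)

theorem sub_mem_proxNormalCone {S : Set H} {z p : H} (hzp : dist z p = infDist z S) :
    z - p ∈ ProxNormalCone S p := by
  refine ⟨1 / 2, by norm_num, 1, one_pos, fun y hy _ => ?_⟩
  have h : ‖z - p‖ ≤ ‖z - y‖ := by
    rw [← dist_eq_norm, ← dist_eq_norm, hzp]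
    exact infDist_le_dist_of_mem hy
  have h1 : ‖z - p‖ ^ 2 ≤ ‖z - y‖ ^ 2 := by gcongr
  have h2 : z - y = (z - p) - (y - p) := by abel
  rw [h2, norm_sub_sq_real (z - p)] at h1
  linarith

end NearestPoints

section ProxRegular

variable {H : Type*} [NormedAddCommGroup H] [InnerProductSpace ℝ H] {ρ : ℝ≥0∞} {S : Set H}

theorem UniformlyProxRegular.infDist_le_of_dist_eq (hSpr : UniformlyProxRegular ρ S)
    {x x' : H} (hx : x ∈ S) (hx' : x' ∈ S) {t : ℝ} (ht0 : 0 ≤ t) (ht1 : t ≤ 1) {z p : H}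
    (hp : p ∈ S) (hzp : dist z p = infDist z S) :
    infDist z S - dist z (x + t • (x' - x)) ≤
      1 / (2 * ρ.toReal) *
        ((infDist z S + dist z (x + t • (x' - x))) ^ 2 + t * (1 - t) * ‖x' - x‖ ^ 2) := by
  set w := x + t • (x' - x) with hw
  set κ := 1 / (2 * ρ.toReal) with hκ
  have hκ0 : 0 ≤ κ := by positivity
  have ht : 0 ≤ 1 - t := by linarith
  have hv := sub_mem_proxNormalCone hzp
  have h1 := hSpr p hp _ hv x hx
  have h2 := hSpr p hp _ hv x' hx'
  rw [← hzp, dist_eq_norm, dist_eq_norm]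
  rw [div_eq_mul_one_div, ← hκ] at h1 h2
  have h3 : ⟪z - p, w - p⟫ ≤ ‖z - p‖ * (κ * (‖w - p‖ ^ 2 + t * (1 - t) * ‖x' - x‖ ^ 2)) := by
    have e : w - p = (1 - t) • (x - p) + t • (x' - p) := by rw [hw]; module
    have e1 := mul_le_mul_of_nonneg_left h1 ht
    have e2 := mul_le_mul_of_nonneg_left h2 ht0
    have e3 := norm_sub_convexComb_sq x x' p t
    rw [← hw] at e3
    rw [e3, e, inner_add_right, real_inner_smul_right, real_inner_smul_right]
    linarith
  have h4 : ‖z - p‖ * (‖z - p‖ - ‖z - w‖) ≤ ⟪z - p, w - p⟫ := by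
    have e : w - p = (z - p) - (z - w) := by abel
    rw [e, inner_sub_right, real_inner_self_eq_norm_sq]
    linarith [real_inner_le_norm (z - p) (z - w)]
  have h5 : ‖w - p‖ ≤ ‖z - p‖ + ‖z - w‖ := by
    have e : w - p = (z - p) - (z - w) := by abel
    rw [e]; exact norm_sub_le _ _
  have h6 : κ * (‖w - p‖ ^ 2 + t * (1 - t) * ‖x' - x‖ ^ 2) ≤
      κ * ((‖z - p‖ + ‖z - w‖) ^ 2 + t * (1 - t) * ‖x' - x‖ ^ 2) := by gcongr
  refine le_trans ?_ h6
  rcases (norm_nonneg (z - p)).eq_or_lt with h0 | h0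
  · have : 0 ≤ κ * (‖w - p‖ ^ 2 + t * (1 - t) * ‖x' - x‖ ^ 2) := by positivity
    linarith [norm_nonneg (z - w)]
  · exact le_of_mul_le_mul_left (h4.trans h3) h0

theorem UniformlyProxRegular.infDist_convexComb_le [CompleteSpace H]
    (hScl : IsClosed S) (hSpr : UniformlyProxRegular ρ S)
    {x x' : H} (hx : x ∈ S) (hx' : x' ∈ S) {t : ℝ} (ht0 : 0 ≤ t) (ht1 : t ≤ 1) :
    infDist (x + t • (x' - x)) S ≤ t * (1 / (2 * ρ.toReal) * ‖x' - x‖ ^ 2) := by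
  set w := x + t • (x' - x) with hw
  set κ := 1 / (2 * ρ.toReal) with hκ
  have hκ0 : 0 ≤ κ := by positivity
  have hcl : IsClosed {z : H | infDist z S - dist z w ≤
      κ * ((infDist z S + dist z w) ^ 2 + t * (1 - t) * ‖x' - x‖ ^ 2)} := by
    have hc : Continuous fun z : H => infDist z S := continuous_infDist_pt S
    apply isClosed_le <;> fun_prop
  have hsub : {z : H | ∃ p ∈ S, dist z p = infDist z S} ⊆ {z : H | infDist z S - dist z w ≤
      κ * ((infDist z S + dist z w) ^ 2 + t * (1 - t) * ‖x' - x‖ ^ 2)} := by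
    rintro z ⟨p, hp, hzp⟩
    exact hSpr.infDist_le_of_dist_eq hx hx' ht0 ht1 hp hzp
  have hwmem := closure_minimal hsub hcl (dense_setOf_exists_dist_eq_infDist ⟨x, hx⟩ hScl w)
  simp only [mem_ofPred_eq, dist_self, sub_zero, add_zero] at hwmem
  have h1 : infDist w S ≤ t * ‖x' - x‖ := by
    refine (infDist_le_dist_of_mem hx).trans_eq ?_
    rw [dist_eq_norm, hw, add_sub_cancel_left, norm_smul, Real.norm_eq_abs, abs_of_nonneg ht0]
  have h2 : infDist w S ^ 2 ≤ (t * ‖x' - x‖) ^ 2 := by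
    have := infDist_nonneg (x := w) (s := S)
    gcongr
  calc infDist w S ≤ κ * (infDist w S ^ 2 + t * (1 - t) * ‖x' - x‖ ^ 2) := hwmem
    _ ≤ κ * ((t * ‖x' - x‖) ^ 2 + t * (1 - t) * ‖x' - x‖ ^ 2) := by gcongr
    _ = t * (κ * ‖x' - x‖ ^ 2) := by ring

/-- Near an endpoint, the segment joining two points of a prox-regular set inside a closed ball of
radius less than `ρ` is approximated by points of the set inside the open ball. -/
theorem UniformlyProxRegular.exists_mem_inter_ball_near_segment [CompleteSpace H]
    (hScl : IsClosed S) (hSpr : UniformlyProxRegular ρ S) {a : H} {r : ℝ} (hr0 : 0 < r)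
    (hrρ : ENNReal.ofReal r < ρ) {x x' : H} (hx : x ∈ S ∩ closedBall a r)
    (hx' : x' ∈ S ∩ closedBall a r) (hne : x ≠ x') {ε : ℝ} (hε : 0 < ε) :
    ∃ t : ℝ, 0 < t ∧ t ≤ ε ∧ ∃ y ∈ S ∩ ball a r,
      ‖y - (x + t • (x' - x))‖ ≤ t * (1 / (2 * ρ.toReal) * ‖x' - x‖ ^ 2 + ε) := by
  have hinf := fun t ht0 ht1 =>
    hSpr.infDist_convexComb_le hScl hx.1 hx'.1 (t := t) ht0 ht1
  set κ := 1 / (2 * ρ.toReal) with hκ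
  have hκ0 : 0 ≤ κ := by positivity
  have hκr : 2 * r * κ < 1 := by
    by_cases h : ρ = ∞
    · simp [hκ, h]
    · have h1 : r < ρ.toReal := (ENNReal.ofReal_lt_iff_lt_toReal hr0.le h).1 hrρ
      have h2 : 0 < ρ.toReal := hr0.trans h1
      rw [hκ, mul_one_div, div_lt_one (by positivity)]
      linarith
  have hd : 0 < ‖x' - x‖ := norm_pos_iff.2 (sub_ne_zero.2 hne.symm)
  set d := ‖x' - x‖ with hd_def
  set g := (1 - 2 * r * κ) * d ^ 2 with hg_def
  have hg : 0 < g := mul_pos (by linarith) (by positivity)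
  obtain ⟨e, he0, heε, heg⟩ : ∃ e : ℝ, 0 < e ∧ e ≤ ε ∧ 2 * r * e < g / 2 := by
    refine ⟨min ε (g / (8 * r)), by positivity, min_le_left _ _, ?_⟩
    calc _ ≤ 2 * r * (g / (8 * r)) := by gcongr; exact min_le_right _ _
      _ = g / 4 := by field_simp; ring
      _ < g / 2 := by linarith
  obtain ⟨t, ht0, htε, ht1, htd, htr⟩ : ∃ t : ℝ, 0 < t ∧ t ≤ ε ∧ t ≤ 1 ∧ t * d ^ 2 ≤ g / 2 ∧
      t * (κ * d ^ 2 + e) ≤ r := by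
    refine ⟨min (min ε 1) (min (g / 2 / d ^ 2) (r / (κ * d ^ 2 + e))), by positivity,
      (min_le_left _ _).trans (min_le_left _ _), (min_le_left _ _).trans (min_le_right _ _),
      ?_, ?_⟩
    · rw [← le_div_iff₀ (by positivity)]
      exact (min_le_right _ _).trans (min_le_left _ _)
    · rw [← le_div_iff₀ (by positivity)]
      exact (min_le_right _ _).trans (min_le_right _ _)
  have hlt : infDist (x + t • (x' - x)) S < t * (κ * d ^ 2 + e) :=
    (hinf t ht0.le ht1).trans_lt (by gcongr; linarith)
  obtain ⟨y, hyS, hy⟩ := (infDist_lt_iff ⟨x, hx.1⟩).1 hlt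
  refine ⟨t, ht0, htε, y, ⟨hyS, ?_⟩, ?_⟩
  · have h1 := hx.2
    have h2 := hx'.2
    rw [mem_closedBall, dist_eq_norm] at h1 h2
    have h3 : ‖x - a‖ ^ 2 ≤ r ^ 2 := by gcongr
    have h4 : ‖x' - a‖ ^ 2 ≤ r ^ 2 := by gcongr
    have h5 := norm_sub_convexComb_sq x x' a t
    rw [← hd_def] at h5
    have h6 : ‖x + t • (x' - x) - a‖ ^ 2 ≤ (r - t * (κ * d ^ 2 + e)) ^ 2 := by
      have e1 : (1 - t) * ‖x - a‖ ^ 2 ≤ (1 - t) * r ^ 2 :=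
        mul_le_mul_of_nonneg_left h3 (by linarith)
      have e2 : t * ‖x' - a‖ ^ 2 ≤ t * r ^ 2 := by gcongr
      have e3 : t * (2 * r * (κ * d ^ 2 + e)) ≤ t * ((1 - t) * d ^ 2) := by
        refine mul_le_mul_of_nonneg_left ?_ ht0.le
        linarith
      linarith [sq_nonneg (t * (κ * d ^ 2 + e))]
    have h7 := (sq_le_sq₀ (norm_nonneg _) (by linarith)).1 h6
    rw [mem_ball]
    rw [dist_comm] at hy
    have := dist_triangle y (x + t • (x' - x)) a
    rw [dist_eq_norm (x + t • (x' - x)) a] at this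
    linarith
  · rw [← dist_eq_norm, dist_comm]
    exact hy.le.trans (by gcongr)

end ProxRegular

/-- For a nonempty closed `ρ`-uniformly prox-regular set `S` and a ball of
radius `r < ρ` meeting `S`, the closure of `S ∩ B_r(a)` is `S ∩ B̄_r[a]`, and
`S ∩ B̄_r[a]` is `ρ`-uniformly prox-regular. -/
theorem closure_inter_ball_eq_and_proxRegular
    {H : Type*} [NormedAddCommGroup H] [InnerProductSpace ℝ H] [CompleteSpace H]
    (ρ : ℝ≥0∞) (hρ : 0 < ρ) (S : Set H) (hSne : S.Nonempty) (hScl : IsClosed S)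
    (hSpr : UniformlyProxRegular ρ S) (a : H) (r : ℝ) (hr0 : 0 < r)
    (hrρ : ENNReal.ofReal r < ρ) (hne : (S ∩ ball a r).Nonempty) :
    closure (S ∩ ball a r) = S ∩ closedBall a r ∧
      UniformlyProxRegular ρ (S ∩ closedBall a r) := by
  have near := fun {x x'} hx hx' hne {ε} hε => hSpr.exists_mem_inter_ball_near_segment hScl hr0 hrρ
    (a := a) (x := x) (x' := x') hx hx' hne (ε := ε) hε
  refine ⟨Subset.antisymm ?_ fun x hx => ?_, fun x hx ζ hζ x' hx' => ?_⟩
  · exact closure_minimal (inter_subset_inter_right _ ball_subset_closedBall)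
      (hScl.inter isClosed_closedBall)
  · obtain ⟨x', hx'⟩ := hne
    by_cases hxx : x = x'
    · exact subset_closure (hxx ▸ hx')
    rw [Metric.mem_closure_iff]
    intro ε hε
    set κ := 1 / (2 * ρ.toReal) with hκ
    have hκ0 : 0 ≤ κ := by positivity
    set M := κ * ‖x' - x‖ ^ 2 + 1 + ‖x' - x‖ with hM
    have hM0 : 0 < M := by positivity
    obtain ⟨t, ht0, htε, y, hy, hyt⟩ := near hx ⟨hx'.1, ball_subset_closedBall hx'.2⟩ hxx
      (ε := min 1 (ε / (2 * M))) (by positivity)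
    refine ⟨y, hy, ?_⟩
    have h1 := norm_sub_le_norm_sub_add_smul x (x' - x) y ht0.le
    have h2 : t * (κ * ‖x' - x‖ ^ 2 + min 1 (ε / (2 * M))) ≤ t * (κ * ‖x' - x‖ ^ 2 + 1) := by
      gcongr; exact min_le_left _ _
    have h3 : t * M ≤ ε / 2 := by
      calc t * M ≤ ε / (2 * M) * M := by gcongr; exact htε.trans (min_le_right _ _)
        _ = ε / 2 := by field_simp
    rw [dist_comm, dist_eq_norm]
    linarith
  · by_cases hxx : x = x'
    · simp [hxx]
    obtain ⟨σ, hσ, η, hη, hprox⟩ := hζ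
    rw [div_eq_mul_one_div]
    set κ := 1 / (2 * ρ.toReal) with hκ
    have hκ0 : 0 ≤ κ := by positivity
    set M := κ * ‖x' - x‖ ^ 2 + 1 + ‖x' - x‖ with hM
    have hM0 : 0 < M := by positivity
    set K := ‖ζ‖ + σ * M ^ 2 + 1 with hK
    have hK0 : 0 < K := by positivity
    refine le_of_forall_pos_le_add fun δ hδ => ?_
    obtain ⟨e, he0, he1, heη, heδ⟩ : ∃ e : ℝ, 0 < e ∧ e ≤ 1 ∧ e * M < η ∧ e * K ≤ δ := by
      refine ⟨min 1 (min (η / (2 * M)) (δ / K)), by positivity, min_le_left _ _, ?_, ?_⟩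
      · calc _ ≤ η / (2 * M) * M := by
              gcongr; exact (min_le_right _ _).trans (min_le_left _ _)
          _ = η / 2 := by field_simp
          _ < η := by linarith
      · rw [← le_div_iff₀ hK0]
        exact (min_le_right _ _).trans (min_le_right _ _)
    obtain ⟨t, ht0, hte, y, hy, hyt⟩ := near hx hx' hxx he0
    have h1 : ‖y - x‖ ≤ t * M := by
      have e1 := norm_sub_le_norm_sub_add_smul x (x' - x) y ht0.le
      have e2 : t * (κ * ‖x' - x‖ ^ 2 + e) ≤ t * (κ * ‖x' - x‖ ^ 2 + 1) := by gcongr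
      linarith
    have h2 := hprox y ⟨hy.1, ball_subset_closedBall hy.2⟩
      (h1.trans_lt ((mul_le_mul_of_nonneg_right hte hM0.le).trans_lt heη))
    have h3 : σ * ‖y - x‖ ^ 2 ≤ σ * (t * M) ^ 2 := by gcongr
    have h4 : -⟪ζ, y - (x + t • (x' - x))⟫ ≤ ‖ζ‖ * (t * (κ * ‖x' - x‖ ^ 2 + e)) := by
      calc _ ≤ ‖ζ‖ * ‖y - (x + t • (x' - x))‖ :=
            (neg_le_abs _).trans (abs_real_inner_le_norm _ _)
        _ ≤ _ := by gcongr
    have h5 : ⟪ζ, y - x⟫ = ⟪ζ, y - (x + t • (x' - x))⟫ + t * ⟪ζ, x' - x⟫ := by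
      rw [← real_inner_smul_right, ← inner_add_right]
      congr 1
      abel
    have h6 : t * ⟪ζ, x' - x⟫ ≤ t * (‖ζ‖ * (κ * ‖x' - x‖ ^ 2 + e) + t * (σ * M ^ 2)) := by
      linarith
    have h7 := le_of_mul_le_mul_left h6 ht0
    have h8 : t * (σ * M ^ 2) ≤ e * (σ * M ^ 2) := by gcongr
    linarith
end

section
/- Let H be a real Hilbert space, T > 0, ρ ∈ (0,∞], and let C : [0,T] ⇉ H satisfy (H₁), (H₂), and (H₃). Let x : [0,T] → H be a map. Then x is an integral solution of the sweeping process driven by C if and only if x is a solution in the sense of differential measures of the sweeping process driven by C. -/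
open MeasureTheory Set Metric Filter Topology
open scoped RealInnerProductSpace ENNReal

/-- `x` is an integral solution of the sweeping process driven by `C` on `[0,T]`. -/
def IsIntegralSolution {H : Type*} [NormedAddCommGroup H] [InnerProductSpace ℝ H]
    (ρ : ℝ≥0∞) (C : ℝ → Set H) (T : ℝ) (x : ℝ → H) : Prop :=
  AdmissibleTrajectory C T x ∧
    ∃ ν : Measure ℝ, IsRadonOn ν T ∧ ∃ v : ℝ → H, HasDensity T ν x v ∧
      ∀ y : ℝ → H, ContinuousOn y (Icc (0:ℝ) T) → (∀ᵐ t ∂ν, y t ∈ C t) →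
        0 ≤ ∫ t in Icc (0:ℝ) T,
          (⟪v t, y t - x t⟫ + ‖v t‖ / (2 * ρ.toReal) * ‖y t - x t‖ ^ 2) ∂ν

/-- `x` is a solution in the sense of differential measures of the sweeping process
driven by `C` on `[0,T]`. -/
def IsDiffMeasureSolution {H : Type*} [NormedAddCommGroup H] [InnerProductSpace ℝ H]
    (C : ℝ → Set H) (T : ℝ) (x : ℝ → H) : Prop :=
  AdmissibleTrajectory C T x ∧
    ∃ ν : Measure ℝ, IsRadonOn ν T ∧ ∃ v : ℝ → H, HasDensity T ν x v ∧
      ∀ᵐ t ∂ν, -v t ∈ ProxNormalCone (C t) (x t)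

/-- On a profinite space, a relation that near every point is satisfied by some constant is
satisfied by some continuous function. -/
lemma exists_continuous_of_forall_eventually {X E : Type*} [TopologicalSpace X] [T2Space X]
    [CompactSpace X] [TotallyDisconnectedSpace X] [TopologicalSpace E] {P : X → E → Prop}
    (h : ∀ s, ∃ c, ∀ᶠ t in 𝓝 s, P t c) : ∃ y : X → E, Continuous y ∧ ∀ t, P t (y t) := by
  choose c hc using h
  choose U hUP hUo hsU using fun s => eventually_nhds_iff.1 (hc s)
  have hcov : TopologicalSpace.IsOpenCover
      (fun s => (⟨U s, hUo s⟩ : TopologicalSpace.Opens X)) :=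
    TopologicalSpace.IsOpenCover.of_sets hUo (iUnion_eq_univ_iff.2 fun s => ⟨s, hsU s⟩)
  obtain ⟨n, W, hW, hWcov, hWdisj⟩ := hcov.exists_finite_nonempty_disjoint_clopen_cover
  choose s hs using fun j => (hW j).2
  choose j hj using fun t => mem_iUnion.1 (hWcov (mem_univ t))
  refine ⟨fun t => c (s (j t)), ?_, fun t => hUP _ _ (hs _ (hj t))⟩
  refine IsLocallyConstant.continuous ((IsLocallyConstant.iff_eventually_eq _).2 fun t => ?_)
  filter_upwards [(W (j t)).isOpen.mem_nhds (hj t)] with t' ht'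
  have : j t' = j t := by
    by_contra hne
    have hd := hWdisj hne
    rw [Function.onFun, ← TopologicalSpace.Clopens.coe_disjoint] at hd
    exact disjoint_left.1 hd (hj t') ht'
  rw [this]

/-- A lower semicontinuous map with nonempty closed values from a profinite space to a complete
metric space has a continuous selection. -/
lemma exists_continuous_selection {X E : Type*} [TopologicalSpace X] [T2Space X]
    [CompactSpace X] [TotallyDisconnectedSpace X] [MetricSpace E] [CompleteSpace E]
    {Φ : X → Set E} (hne : ∀ t, (Φ t).Nonempty) (hcl : ∀ t, IsClosed (Φ t))
    (hlsc : ∀ t U, IsOpen U → (Φ t ∩ U).Nonempty → ∀ᶠ t' in 𝓝 t, (Φ t' ∩ U).Nonempty) :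
    ∃ y : X → E, Continuous y ∧ ∀ t, y t ∈ Φ t := by
  have hpos : ∀ n : ℕ, (0 : ℝ) < (1 / 2) ^ n := fun n => by positivity
  have start : ∃ y : X → E, Continuous y ∧ ∀ t, (Φ t ∩ ball (y t) ((1 / 2) ^ 0)).Nonempty :=
    exists_continuous_of_forall_eventually (P := fun t c => (Φ t ∩ ball c ((1 / 2) ^ 0)).Nonempty)
      fun s => by
        obtain ⟨c, hc⟩ := hne s
        exact ⟨c, hlsc s _ isOpen_ball ⟨c, hc, mem_ball_self (hpos 0)⟩⟩
  have step : ∀ n : ℕ, ∀ y : X → E,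
      Continuous y ∧ (∀ t, (Φ t ∩ ball (y t) ((1 / 2) ^ n)).Nonempty) →
      ∃ y' : X → E, (Continuous y' ∧ ∀ t, (Φ t ∩ ball (y' t) ((1 / 2) ^ (n + 1))).Nonempty) ∧
        ∀ t, dist (y t) (y' t) ≤ 1 * (1 / 2) ^ n := by
    rintro n y ⟨hy, hyΦ⟩
    obtain ⟨y', hy', h⟩ := exists_continuous_of_forall_eventually
      (P := fun t c => (Φ t ∩ ball c ((1 / 2) ^ (n + 1))).Nonempty ∧ dist (y t) c < (1 / 2) ^ n)
      fun s => by
        obtain ⟨c, hc, hcy⟩ := hyΦ s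
        refine ⟨c, (hlsc s _ isOpen_ball ⟨c, hc, mem_ball_self (hpos _)⟩).and ?_⟩
        exact (hy.dist continuous_const).continuousAt.eventually_lt continuousAt_const
          (mem_ball'.1 hcy)
    exact ⟨y', ⟨hy', fun t => (h t).1⟩, fun t => by rw [one_mul]; exact (h t).2.le⟩
  choose! F hF hFd using step
  obtain ⟨y₀, hy₀⟩ := start
  let y : ℕ → X → E := fun n => Nat.rec y₀ (fun n z => F n z) n
  have hy : ∀ n, Continuous (y n) ∧ ∀ t, (Φ t ∩ ball (y n t) ((1 / 2) ^ n)).Nonempty := by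
    intro n
    induction n with
    | zero => exact hy₀
    | succ n ih => exact hF n _ ih
  have hd : ∀ t n, dist (y n t) (y (n + 1) t) ≤ 1 * (1 / 2) ^ n := fun t n => hFd n _ (hy n) t
  choose z hz using fun t =>
    cauchySeq_tendsto_of_complete (cauchySeq_of_le_geometric _ _ (by norm_num) (hd t))
  have hgeom : Tendsto (fun n : ℕ => (1 / 2 : ℝ) ^ n) atTop (𝓝 0) :=
    tendsto_pow_atTop_nhds_zero_of_lt_one (by norm_num) (by norm_num)
  refine ⟨z, ?_, fun t => ?_⟩
  · have hu : TendstoUniformly y z atTop := by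
      rw [Metric.tendstoUniformly_iff]
      intro ε hε
      have h2 : Tendsto (fun n : ℕ => 1 * (1 / 2 : ℝ) ^ n / (1 - 1 / 2)) atTop (𝓝 0) := by
        simpa using (hgeom.const_mul 1).div_const (1 - 1 / 2)
      filter_upwards [h2.eventually_lt_const hε] with n hn t
      rw [dist_comm]
      exact (dist_le_of_le_geometric_of_tendsto _ _ (by norm_num) (hd t) (hz t) n).trans_lt hn
    exact hu.continuous (Frequently.of_forall fun n => (hy n).1)
  · choose w hwΦ hw using fun n => (hy n).2 t
    refine (hcl t).mem_of_tendsto (f := w) (b := atTop) ?_ (Eventually.of_forall hwΦ)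
    refine (tendsto_iff_of_dist ?_).1 (hz t)
    refine squeeze_zero (fun _ => dist_nonneg) (fun n => ?_) hgeom
    exact (mem_ball'.1 (hw n)).le

/-- The selection of `exists_continuous_selection` may be prescribed at one point. -/
lemma exists_continuous_selection_through {X E : Type*} [TopologicalSpace X] [T2Space X]
    [CompactSpace X] [TotallyDisconnectedSpace X] [MetricSpace E] [CompleteSpace E]
    {Φ : X → Set E} (hne : ∀ t, (Φ t).Nonempty) (hcl : ∀ t, IsClosed (Φ t))
    (hlsc : ∀ t U, IsOpen U → (Φ t ∩ U).Nonempty → ∀ᶠ t' in 𝓝 t, (Φ t' ∩ U).Nonempty)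
    {t₀ : X} {z₀ : E} (hz₀ : z₀ ∈ Φ t₀) :
    ∃ y : X → E, Continuous y ∧ (∀ t, y t ∈ Φ t) ∧ y t₀ = z₀ := by
  classical
  let Ψ : X → Set E := fun t => if t = t₀ then {z₀} else Φ t
  have hΨ₀ : Ψ t₀ = {z₀} := if_pos rfl
  have hΨ : ∀ t, t ≠ t₀ → Ψ t = Φ t := fun t ht => if_neg ht
  have hsub : ∀ t, Ψ t ⊆ Φ t := by
    intro t
    rcases eq_or_ne t t₀ with rfl | ht
    · rw [hΨ₀]; exact singleton_subset_iff.2 hz₀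
    · rw [hΨ t ht]
  have hneΨ : ∀ t, (Ψ t).Nonempty := by
    intro t
    rcases eq_or_ne t t₀ with rfl | ht
    · rw [hΨ₀]; exact singleton_nonempty _
    · rw [hΨ t ht]; exact hne t
  have hclΨ : ∀ t, IsClosed (Ψ t) := by
    intro t
    rcases eq_or_ne t t₀ with rfl | ht
    · rw [hΨ₀]; exact isClosed_singleton
    · rw [hΨ t ht]; exact hcl t
  have hlscΨ : ∀ t U, IsOpen U → (Ψ t ∩ U).Nonempty →
      ∀ᶠ t' in 𝓝 t, (Ψ t' ∩ U).Nonempty := by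
    intro t U hU h
    have hev := hlsc t U hU (h.mono (inter_subset_inter_left _ (hsub t)))
    rcases eq_or_ne t t₀ with rfl | ht
    · filter_upwards [hev] with t' ht'
      rcases eq_or_ne t' t with rfl | hne'
      · exact h
      · rwa [hΨ t' hne']
    · filter_upwards [hev, isOpen_ne.mem_nhds ht] with t' ht' hne'
      rwa [hΨ t' hne']
  obtain ⟨y, hy, hyΨ⟩ := exists_continuous_selection hneΨ hclΨ hlscΨ
  exact ⟨y, hy, fun t => hsub t (hyΨ t), by simpa [hΨ₀] using hyΨ t₀⟩

/-- **Lusin's theorem** for integrable functions. -/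
lemma exists_isCompact_continuousOn_measure_sdiff_le {E : Type*} [NormedAddCommGroup E]
    [NormedSpace ℝ E] {ν : Measure ℝ} [IsFiniteMeasure ν] {f : ℝ → E} (hf : Integrable f ν)
    {S : Set ℝ} (hS : MeasurableSet S) {ε : ℝ} (hε : 0 < ε) :
    ∃ K ⊆ S, IsCompact K ∧ ContinuousOn f K ∧ ν (S \ K) ≤ ENNReal.ofReal ε := by
  have hpos : ∀ n : ℕ, ((2 : ℝ≥0∞)⁻¹) ^ n ≠ 0 := fun n => by simp
  choose g hg _ using fun n => hf.exists_boundedContinuous_lintegral_sub_le (hpos n)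
  have hLp : Tendsto (fun n => eLpNorm ((fun n t => g n t) n - f) 1 ν) atTop (𝓝 0) := by
    refine tendsto_of_tendsto_of_tendsto_of_le_of_le tendsto_const_nhds
      (ENNReal.tendsto_pow_atTop_nhds_zero_of_lt_one (r := 2⁻¹) (by simp))
      (fun _ => zero_le) fun n => ?_
    rw [eLpNorm_sub_comm, eLpNorm_one_eq_lintegral_enorm]
    exact hg n
  obtain ⟨φ, -, hφ⟩ := (tendstoInMeasure_of_tendsto_eLpNorm one_ne_zero
    (fun n => (g n).continuous.aestronglyMeasurable) hf.1 hLp).exists_seq_tendsto_ae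
  have hφ' : ∀ᵐ t ∂ν, Tendsto (fun n => g (φ n) t) atTop (𝓝 (hf.1.mk f t)) := by
    filter_upwards [hφ, hf.1.ae_eq_mk] with t ht hm
    rwa [← hm]
  obtain ⟨B, hBm, hB, hu⟩ := tendstoUniformlyOn_of_ae_tendsto'
    (fun n => (g (φ n)).continuous.stronglyMeasurable) hf.1.stronglyMeasurable_mk hφ'
    (half_pos hε)
  obtain ⟨N, hN, hNm, hN0⟩ := exists_measurable_superset_of_null hf.1.ae_eq_mk
  have hmeas : MeasurableSet ((S \ B) \ N) := (hS.diff hBm).diff hNm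
  obtain ⟨K, hKsub, hK, hKν⟩ := hmeas.exists_isCompact_sdiff_lt (measure_ne_top ν _)
    (ε := ENNReal.ofReal (ε / 2)) (by simpa using hε)
  refine ⟨K, fun t ht => (hKsub ht).1.1, hK, ?_, ?_⟩
  · have hc : ContinuousOn (hf.1.mk f) K :=
      (hu.mono fun t ht => (hKsub ht).1.2).continuousOn
        (Frequently.of_forall fun n => (g (φ n)).continuous.continuousOn)
    refine hc.congr fun t ht => ?_
    by_contra hne
    exact (hKsub ht).2 (hN hne)
  · calc ν (S \ K) ≤ ν (B ∪ N ∪ (((S \ B) \ N) \ K)) := by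
          refine measure_mono fun t ht => ?_
          by_cases h1 : t ∈ B
          · exact Or.inl (Or.inl h1)
          by_cases h2 : t ∈ N
          · exact Or.inl (Or.inr h2)
          exact Or.inr ⟨⟨⟨ht.1, h1⟩, h2⟩, ht.2⟩
      _ ≤ ν B + ν N + ν (((S \ B) \ N) \ K) :=
          (measure_union_le _ _).trans (by gcongr; exact measure_union_le _ _)
      _ ≤ ENNReal.ofReal (ε / 2) + 0 + ENNReal.ofReal (ε / 2) := by gcongr; exact hN0.le
      _ = ENNReal.ofReal ε := by
          rw [add_zero, ← ENNReal.ofReal_add (by positivity) (by positivity), add_halves]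

/-- A finite Borel measure on the line has a countable dense null set. -/
lemma exists_countable_dense_null (ν : Measure ℝ) [IsFiniteMeasure ν] :
    ∃ D : Set ℝ, D.Countable ∧ Dense D ∧ ν D = 0 := by
  have hatoms : {t : ℝ | 0 < ν {t}}.Countable :=
    Measure.countable_meas_pos_of_disjoint_iUnion (fun t => measurableSet_singleton t)
      fun s t hst => disjoint_singleton.2 hst
  obtain ⟨D, hD, hDc, hDd⟩ := (hatoms.dense_compl ℝ).exists_countable_dense_subset
  refine ⟨D, hDc, hDd, ?_⟩
  rw [← biUnion_of_singleton D, measure_biUnion_null_iff hDc]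
  intro t ht
  simpa using hD ht

lemma isTotallyDisconnected_of_disjoint_dense {K D : Set ℝ} (hD : Dense D)
    (h : Disjoint K D) : IsTotallyDisconnected K := by
  intro s hsK hs a ha b hb
  by_contra hne
  wlog hab : a < b generalizing a b
  · exact this hb ha (Ne.symm hne) (lt_of_le_of_ne (not_lt.1 hab) (Ne.symm hne))
  obtain ⟨d, hdD, hd⟩ := hD.exists_between hab
  exact disjoint_left.1 h (hsK (hs.Icc_subset ha hb ⟨hd.1.le, hd.2.le⟩)) hdD

/-- A primitive `t ↦ ∫_{(0,t]} v dν` is strongly measurable. -/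
lemma stronglyMeasurable_setIntegral_Ioc {E : Type*} [NormedAddCommGroup E] [NormedSpace ℝ E]
    {ν : Measure ℝ} [IsFiniteMeasure ν] {v : ℝ → E} (hv : AEStronglyMeasurable v ν) :
    StronglyMeasurable fun t => ∫ s in Ioc (0 : ℝ) t, v s ∂ν := by
  have hS : MeasurableSet {p : ℝ × ℝ | p.2 ∈ Ioc 0 p.1} :=
    (measurableSet_lt measurable_const measurable_snd).inter
      (measurableSet_le measurable_snd measurable_fst)
  have h := ((hv.stronglyMeasurable_mk.comp_measurable measurable_snd).indicator
    hS).integral_prod_right' (ν := ν)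
  convert h using 2 with t
  rw [← integral_indicator measurableSet_Ioc]
  refine integral_congr_ae ?_
  filter_upwards [hv.ae_eq_mk] with s hs
  simp only [indicator, mem_ofPred_eq, Function.comp, hs]

section Density

variable {H : Type*} [NormedAddCommGroup H] [InnerProductSpace ℝ H] {T r : ℝ} {ν : Measure ℝ}
  {x v : ℝ → H}

lemma HasDensity.norm_le (h : HasDensity T ν x v) :
    ∀ t ∈ Icc (0 : ℝ) T, ‖x t‖ ≤ ‖x 0‖ + ∫ s, ‖v s‖ ∂ν := by
  intro t ht
  rw [h.2 t ht]
  refine (norm_add_le _ _).trans (add_le_add_right ?_ _)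
  exact (norm_integral_le_integral_norm _).trans
    (setIntegral_le_integral h.1.norm (Eventually.of_forall fun s => norm_nonneg _))

lemma HasDensity.integrable (hν : IsRadonOn ν T) (h : HasDensity T ν x v) : Integrable x ν := by
  have := hν.1
  have hmem : ∀ᵐ t ∂ν, t ∈ Icc (0 : ℝ) T := hν.2.2
  refine Integrable.of_bound (C := ‖x 0‖ + ∫ s, ‖v s‖ ∂ν) ?_ ?_
  · refine ((stronglyMeasurable_setIntegral_Ioc h.1.1).const_add
      (x 0)).aestronglyMeasurable.congr ?_
    filter_upwards [hmem] with t ht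
    exact (h.2 t ht).symm
  · filter_upwards [hmem] with t ht
    exact h.norm_le t ht

/-- The integrand of the variational inequality. -/
noncomputable def sweepingIntegrand (r : ℝ) (v w : H) : ℝ := ⟪v, w⟫ + ‖v‖ / r * ‖w‖ ^ 2

lemma abs_sweepingIntegrand_le (hr : 0 ≤ r) {B : ℝ} {v w : H} (hw : ‖w‖ ≤ B) :
    ‖sweepingIntegrand r v w‖ ≤ (B + B ^ 2 / r) * ‖v‖ := by
  have h1 : |⟪v, w⟫| ≤ ‖v‖ * B :=
    (abs_real_inner_le_norm v w).trans (by gcongr)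
  have h2 : ‖v‖ / r * ‖w‖ ^ 2 ≤ ‖v‖ / r * B ^ 2 := by gcongr
  have h3 : 0 ≤ ‖v‖ / r * ‖w‖ ^ 2 := by positivity
  calc ‖sweepingIntegrand r v w‖ ≤ |⟪v, w⟫| + |‖v‖ / r * ‖w‖ ^ 2| := abs_add_le _ _
    _ ≤ ‖v‖ * B + ‖v‖ / r * B ^ 2 := by rw [abs_of_nonneg h3]; gcongr
    _ = (B + B ^ 2 / r) * ‖v‖ := by ring

lemma continuous_sweepingIntegrand (r : ℝ) :
    Continuous fun p : H × H => sweepingIntegrand r p.1 p.2 := by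
  unfold sweepingIntegrand
  fun_prop

@[simp]
lemma sweepingIntegrand_zero_right (r : ℝ) (v : H) : sweepingIntegrand r v 0 = 0 := by
  simp [sweepingIntegrand]

lemma integrableOn_sweepingIntegrand (hr : 0 ≤ r) {S : Set ℝ} (hS : MeasurableSet S)
    (hv : Integrable v ν) (hx : Integrable x ν) {y : ℝ → H} (hy : ContinuousOn y S) {B : ℝ}
    (hB : ∀ t ∈ S, ‖y t - x t‖ ≤ B) :
    IntegrableOn (fun t => sweepingIntegrand r (v t) (y t - x t)) S ν := by
  refine Integrable.mono' (hv.norm.const_mul (B + B ^ 2 / r)).integrableOn ?_ ?_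
  · exact (continuous_sweepingIntegrand r).comp_aestronglyMeasurable
      (hv.1.restrict.prodMk ((hy.aestronglyMeasurable hS).sub hx.1.restrict))
  · exact (ae_restrict_iff' hS).2
      (Eventually.of_forall fun t ht => abs_sweepingIntegrand_le hr (hB t ht))

/-- The variational inequality for global continuous selections localizes to continuous selections
on compact sets. -/
lemma setIntegral_sweepingIntegrand_nonneg {C : ℝ → Set H} (hr : 0 ≤ r)
    (hC3 : SelectionExtension C T) (hν : IsRadonOn ν T) (hxC : ∀ t ∈ Icc (0 : ℝ) T, x t ∈ C t)
    (hd : HasDensity T ν x v)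
    (hint : ∀ y : ℝ → H, ContinuousOn y (Icc (0 : ℝ) T) → (∀ᵐ t ∂ν, y t ∈ C t) →
      0 ≤ ∫ t in Icc (0 : ℝ) T, sweepingIntegrand r (v t) (y t - x t) ∂ν)
    {A : Set ℝ} (hA : IsCompact A) (hAT : A ⊆ Icc (0 : ℝ) T) {z : ℝ → H}
    (hz : ContinuousOn z A) (hzC : ∀ t ∈ A, z t ∈ C t) :
    0 ≤ ∫ t in A, sweepingIntegrand r (v t) (z t - x t) ∂ν := by
  classical
  have := hν.1
  have hmem : ∀ᵐ t ∂ν, t ∈ Icc (0 : ℝ) T := hν.2.2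
  have hx := hd.integrable hν
  set M := ‖x 0‖ + ∫ s, ‖v s‖ ∂ν with hM
  have hxM : ∀ t ∈ Icc (0 : ℝ) T, ‖x t‖ ≤ M := hd.norm_le
  have hM0 : 0 ≤ M := by positivity
  obtain ⟨Mz, hMz⟩ := hA.exists_bound_of_continuousOn hz
  have hη : 0 < max Mz 0 + M + 1 := by positivity
  obtain ⟨R, -, hR⟩ := hC3 x ⟨M, hxM⟩ hxC _ hη
  have hSm : MeasurableSet (Icc (0 : ℝ) T \ A) := measurableSet_Icc.diff hA.measurableSet
  choose K hKS hK hxK hKν using fun n : ℕ =>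
    exists_isCompact_continuousOn_measure_sdiff_le hx hSm (Nat.one_div_pos_of_nat (α := ℝ) (n := n))
  set L := R + M + (R + M) ^ 2 / r
  have hbound : ∀ n, -(L * ∫ t in (Icc (0 : ℝ) T \ A) \ K n, ‖v t‖ ∂ν) ≤
      ∫ t in A, sweepingIntegrand r (v t) (z t - x t) ∂ν := by
    intro n
    have hdisj : Disjoint A (K n) := disjoint_left.2 fun t htA htK => (hKS n htK).2 htA
    let y : ℝ → H := fun t => if t ∈ A then z t else x t
    have hyA : EqOn y z A := fun t ht => if_pos ht
    have hyK : EqOn y x (K n) := fun t ht => if_neg (hKS n ht).2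
    obtain ⟨yb, hyb, hybC, hyby, hybR⟩ := hR (A ∪ K n) (hA.union (hK n))
      (union_subset hAT fun t ht => (hKS n ht).1) y
      ((hz.congr hyA).union_of_isClosed ((hxK n).congr hyK) hA.isClosed (hK n).isClosed)
      (by
        rintro t (ht | ht)
        · rw [hyA ht]; exact hzC t ht
        · rw [hyK ht]; exact hxC t (hKS n ht).1)
      (by
        rintro t (ht | ht)
        · rw [hyA ht]
          refine (norm_sub_le _ _).trans ?_
          linarith [hMz t ht, hxM t (hAT ht), le_max_left Mz 0]
        · rw [hyK ht, sub_self, norm_zero]; exact hη.le)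
    have hB : ∀ t ∈ Icc (0 : ℝ) T, ‖yb t - x t‖ ≤ R + M := fun t ht =>
      (norm_sub_le _ _).trans (add_le_add (hybR t ht) (hxM t ht))
    set G := fun t => sweepingIntegrand r (v t) (yb t - x t)
    have hG : IntegrableOn G (Icc 0 T) ν :=
      integrableOn_sweepingIntegrand hr measurableSet_Icc hd.1 hx hyb hB
    have h0 : 0 ≤ ∫ t in Icc (0 : ℝ) T, G t ∂ν :=
      hint yb hyb (hmem.mono fun t ht => hybC t ht)
    have hsplitA : ∫ t in Icc (0 : ℝ) T, G t ∂ν =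
        ∫ t in A, G t ∂ν + ∫ t in Icc (0 : ℝ) T \ A, G t ∂ν := by
      rw [setIntegral_sdiff hA.measurableSet hG hAT]; ring
    have hsplitK : ∫ t in Icc (0 : ℝ) T \ A, G t ∂ν =
        ∫ t in K n, G t ∂ν + ∫ t in (Icc (0 : ℝ) T \ A) \ K n, G t ∂ν := by
      rw [setIntegral_sdiff (hK n).measurableSet (hG.mono_set sdiff_subset) (hKS n)]; ring
    have hGA : ∫ t in A, G t ∂ν = ∫ t in A, sweepingIntegrand r (v t) (z t - x t) ∂ν :=
      setIntegral_congr_fun hA.measurableSet fun t ht => by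
        simp only [G, hyby t (Or.inl ht), hyA ht]
    have hGK : ∫ t in K n, G t ∂ν = 0 :=
      setIntegral_eq_zero_of_forall_eq_zero fun t ht => by
        simp only [G, hyby t (Or.inr ht), hyK ht, sub_self, sweepingIntegrand_zero_right]
    have hrest : ∫ t in (Icc (0 : ℝ) T \ A) \ K n, G t ∂ν ≤
        L * ∫ t in (Icc (0 : ℝ) T \ A) \ K n, ‖v t‖ ∂ν := by
      rw [← integral_const_mul]
      refine setIntegral_mono_on (hG.mono_set (sdiff_subset.trans sdiff_subset))
        (hd.1.norm.const_mul L).integrableOn (hSm.diff (hK n).measurableSet) fun t ht => ?_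
      exact (le_abs_self _).trans (abs_sweepingIntegrand_le hr (hB t ht.1.1))
    linarith
  have hlim : Tendsto (fun n => ∫ t in (Icc (0 : ℝ) T \ A) \ K n, ‖v t‖ ∂ν) atTop (𝓝 0) := by
    refine hd.1.norm.tendsto_setIntegral_nhds_zero ?_
    refine tendsto_of_tendsto_of_tendsto_of_le_of_le tendsto_const_nhds ?_
      (fun _ => zero_le) hKν
    simpa using ENNReal.tendsto_ofReal (tendsto_one_div_add_atTop_nhds_zero_nat (𝕜 := ℝ))
  have hlim' := (hlim.const_mul L).neg
  rw [mul_zero, neg_zero] at hlim'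
  exact le_of_tendsto' hlim' hbound

/-- The integral variational inequality implies the pointwise one, almost everywhere. -/
lemma ae_forall_sweepingIntegrand_nonneg [CompleteSpace H] {C : ℝ → Set H} (hr : 0 ≤ r)
    (hne : ∀ t ∈ Icc (0 : ℝ) T, (C t).Nonempty) (hcl : ∀ t ∈ Icc (0 : ℝ) T, IsClosed (C t))
    (hC2 : LscOn C (Icc (0 : ℝ) T))
    (hC3 : SelectionExtension C T) (hν : IsRadonOn ν T) (hxC : ∀ t ∈ Icc (0 : ℝ) T, x t ∈ C t)
    (hd : HasDensity T ν x v)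
    (hint : ∀ y : ℝ → H, ContinuousOn y (Icc (0 : ℝ) T) → (∀ᵐ t ∂ν, y t ∈ C t) →
      0 ≤ ∫ t in Icc (0 : ℝ) T, sweepingIntegrand r (v t) (y t - x t) ∂ν) :
    ∀ᵐ t ∂ν, ∀ z ∈ C t, 0 ≤ sweepingIntegrand r (v t) (z - x t) := by
  classical
  have := hν.1
  have hx := hd.integrable hν
  obtain ⟨D, hDc, hDd, hD0⟩ := exists_countable_dense_null ν
  have hSm : MeasurableSet (Icc (0 : ℝ) T \ D) := measurableSet_Icc.diff hDc.measurableSet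
  set bad := {t | ¬ ∀ z ∈ C t, 0 ≤ sweepingIntegrand r (v t) (z - x t)}
  change ν bad = 0
  have key : ∀ A ⊆ Icc (0 : ℝ) T \ D, IsCompact A → ContinuousOn (fun t => (v t, x t)) A →
      ν (bad ∩ A) = 0 := by
    intro A hAS hA hcont
    have hAT : A ⊆ Icc (0 : ℝ) T := hAS.trans sdiff_subset
    have : CompactSpace A := isCompact_iff_compactSpace.1 hA
    have : TotallyDisconnectedSpace A := by
      rw [totallyDisconnectedSpace_subtype_iff]
      exact isTotallyDisconnected_of_disjoint_dense hDd
        (disjoint_left.2 fun t ht => (hAS ht).2)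
    refine measure_null_of_locally_null _ fun t₀ ht₀ => ?_
    obtain ⟨hbad, htA⟩ := ht₀
    simp only [bad, mem_ofPred_eq, not_forall, not_le] at hbad
    obtain ⟨z₀, hz₀, hneg⟩ := hbad
    obtain ⟨y, hy, hyC, hyt₀⟩ := exists_continuous_selection_through
      (Φ := fun t : A => C t) (fun t => hne t (hAT t.2)) (fun t => hcl t (hAT t.2))
      (fun t U hU h => by
        have hcont : Tendsto ((↑) : A → ℝ) (𝓝 t) (𝓝[Icc (0 : ℝ) T] t) :=
          tendsto_nhdsWithin_iff.2
            ⟨continuous_subtype_val.continuousAt, Eventually.of_forall fun s => hAT s.2⟩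
        filter_upwards [hcont (hC2 t (hAT t.2) U hU h)] with s hs using hs.2)
      (t₀ := ⟨t₀, htA⟩) hz₀
    let z : ℝ → H := fun t => if h : t ∈ A then y ⟨t, h⟩ else 0
    have hzy : A.domRestrict z = y := by
      ext t
      simp [z]
    have hz : ContinuousOn z A := continuousOn_iff_continuous_domRestrict.2 (by rwa [hzy])
    have hzC : ∀ t ∈ A, z t ∈ C t := fun t ht => by
      simpa [z, ht] using hyC ⟨t, ht⟩
    have hzt₀ : z t₀ = z₀ := by simpa [z, htA] using hyt₀
    set g := fun t => sweepingIntegrand r (v t) (z t - x t)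
    have hg : ContinuousOn g A :=
      (continuous_sweepingIntegrand r).comp_continuousOn
        (hcont.fst.prodMk (hz.sub hcont.snd))
    have hgt₀ : g t₀ < 0 := by simpa only [g, hzt₀] using hneg
    obtain ⟨δ, hδ, hball⟩ := (nhdsWithin_hasBasis nhds_basis_closedBall A).mem_iff.1
      ((hg t₀ htA).eventually_lt_const hgt₀)
    have hA' : IsCompact (closedBall t₀ δ ∩ A) := hA.inter_left isClosed_closedBall
    have hnn := setIntegral_sweepingIntegrand_nonneg hr hC3 hν hxC hd hint hA'
      (inter_subset_right.trans hAT) (hz.mono inter_subset_right) fun t ht => hzC t ht.2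
    refine ⟨closedBall t₀ δ ∩ A, ?_, ?_⟩
    · exact mem_of_superset
        (inter_mem (mem_nhdsWithin_of_mem_nhds (closedBall_mem_nhds t₀ hδ)) self_mem_nhdsWithin)
        fun t ht => ⟨ht.1, ht.2.2⟩
    · by_contra hpos
      have hgi : IntegrableOn g (closedBall t₀ δ ∩ A) ν :=
        (hg.mono inter_subset_right).integrableOn_compact hA'
      have hlt : 0 < ∫ t in closedBall t₀ δ ∩ A, (-g) t ∂ν := by
        rw [setIntegral_pos_iff_support_of_nonneg_ae _ hgi.neg]
        · refine (pos_iff_ne_zero.2 hpos).trans_le (measure_mono fun t ht => ⟨?_, ht⟩)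
          exact (neg_pos.2 (hball ht)).ne'
        · exact (ae_restrict_iff' hA'.measurableSet).2
            (Eventually.of_forall fun t ht => (neg_pos.2 (hball ht)).le)
      rw [integral_neg'] at hlt
      linarith
  refine le_antisymm (ENNReal.le_of_forall_pos_le_add fun ε hε _ => ?_) zero_le
  obtain ⟨A, hAS, hA, hcont, hAν⟩ := exists_isCompact_continuousOn_measure_sdiff_le
    (hd.1.prodMk hx) hSm (ε := ε) (by exact_mod_cast hε)
  calc ν bad ≤ ν ((bad ∩ A) ∪ ((Icc (0 : ℝ) T)ᶜ ∪ D ∪ ((Icc (0 : ℝ) T \ D) \ A))) := by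
        refine measure_mono fun t ht => ?_
        by_cases h1 : t ∈ A
        · exact Or.inl ⟨ht, h1⟩
        by_cases h2 : t ∈ D
        · exact Or.inr (Or.inl (Or.inr h2))
        by_cases h3 : t ∈ Icc (0 : ℝ) T
        · exact Or.inr (Or.inr ⟨⟨h3, h2⟩, h1⟩)
        · exact Or.inr (Or.inl (Or.inl h3))
    _ ≤ ν (bad ∩ A) + (ν (Icc (0 : ℝ) T)ᶜ + ν D + ν ((Icc (0 : ℝ) T \ D) \ A)) := by
        refine (measure_union_le _ _).trans (add_le_add_right ?_ _)
        exact (measure_union_le _ _).trans (add_le_add_left (measure_union_le _ _) _)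
    _ ≤ 0 + ε := by
        rw [key A hAS hA hcont, hν.2.2, hD0, zero_add, zero_add, zero_add, zero_add]
        simpa using hAν

end Density

/-- **main equivalence.** Under (H₁), (H₂), (H₃), a map `x` is an integral
solution of the sweeping process iff it is a solution in the sense of differential measures. -/
theorem integralSolution_iff_diffMeasureSolution
    {H : Type*} [NormedAddCommGroup H] [InnerProductSpace ℝ H] [CompleteSpace H]
    (T : ℝ) (hT : 0 < T) (ρ : ℝ≥0∞) (hρ : 0 < ρ) (C : ℝ → Set H)
    (hC1 : HypH1 ρ C T) (hC2 : LscOn C (Icc (0:ℝ) T)) (hC3 : SelectionExtension C T)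
    (x : ℝ → H) :
    IsIntegralSolution ρ C T x ↔ IsDiffMeasureSolution C T x := by
  have hr : 0 ≤ 2 * ρ.toReal := by positivity
  constructor
  · rintro ⟨hx, ν, hν, v, hd, hint⟩
    refine ⟨hx, ν, hν, v, hd, ?_⟩
    filter_upwards [ae_forall_sweepingIntegrand_nonneg hr (fun t ht => (hC1 t ht).1)
      (fun t ht => (hC1 t ht).2.1) hC2 hC3 hν hx.2.2.2 hd hint] with t ht
    refine ⟨‖v t‖ / (2 * ρ.toReal), by positivity, 1, one_pos, fun y hy _ => ?_⟩
    have h := ht y hy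
    rw [sweepingIntegrand] at h
    rw [inner_neg_left]
    linarith
  · rintro ⟨hx, ν, hν, v, hd, hv⟩
    refine ⟨hx, ν, hν, v, hd, fun y _ hyC => integral_nonneg_of_ae (ae_restrict_of_ae ?_)⟩
    have hmem : ∀ᵐ t ∂ν, t ∈ Icc (0 : ℝ) T := hν.2.2
    filter_upwards [hv, hyC, hmem] with t hvt hyt ht
    have h := (hC1 t ht).2.2.2 (x t) (hx.2.2.2 t ht) _ hvt _ hyt
    rw [inner_neg_left, norm_neg] at h
    simp only [Pi.zero_apply]
    linarith
end
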